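/- Let r ≥ 3t with t ≥ 1, let H be an (r,t)-graph, and let e_1, e_2, e_3 be edges of H. Set t_1 = |e_1 ∩ e_2 ∩ e_3| and t_2 = |(e_1 ∩ e_2) \ e_3| + |(e_1 ∩ e_3) \ e_2| + |(e_2 ∩ e_3) \ e_1|. Then: if r − 3t + 1 + t_2 ≤ t_1 ≤ r, then 3·τ(H) ≤ 2t_1 + t_2 + r − 3t + 3; if r − 3t + 1 − t_2 ≤ t_1 ≤ r − 3t + 1 + t_2, then τ(H) ≤ r − 3t + 1 + t_2; and if t_1 ≤ r − 3t + 1 − t_2, then τ(H) ≤ 3r − 2t_1 − t_2 − 9t + 3 (inequalities of integers). -/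

import Mathlib

/-- `E` is the edge set of an `r`-uniform `r`-partite hypergraph on vertex type `V`
with parts given by the fibres of `part`: each edge contains exactly one vertex
from each of the `r` parts. -/
def IsRPartite {V : Type} (r : ℕ) (part : V → Fin r) (E : Finset (Finset V)) : Prop :=
  ∀ e ∈ E, ∀ j : Fin r, (e.filter (fun v => part v = j)).card = 1

/-- The hypergraph with edge set `E` is `t`-intersecting. -/
def IntersectingGe {V : Type} (t : ℕ) (E : Finset (Finset V)) : Prop :=
  ∀ e ∈ E, ∀ f ∈ E, t ≤ ((↑e ∩ ↑f : Set V)).ncard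

/-- `C` is a vertex cover of the hypergraph with edge set `E`. -/
def IsCover {V : Type} (E : Finset (Finset V)) (C : Finset V) : Prop :=
  ∀ e ∈ E, ∃ v ∈ e, v ∈ C

/-- The cover number: the minimum size of a vertex cover. -/
noncomputable def coverNumber {V : Type} (E : Finset (Finset V)) : ℕ :=
  sInf {n | ∃ C : Finset V, IsCover E C ∧ C.card = n}

open Finset

/-- `a` lists the vertices of `e`, with `a j` its unique vertex in part `j`. -/
structure IsTransversalOf {V : Type} {r : ℕ} (part : V → Fin r) (a : Fin r → V)
    (e : Finset V) : Prop where
  part_apply : ∀ j, part (a j) = j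
  mem_iff : ∀ v, v ∈ e ↔ v = a (part v)

theorem IsRPartite.exists_transversal {V : Type} {r : ℕ} {part : V → Fin r}
    {E : Finset (Finset V)} (hP : IsRPartite r part E) {e : Finset V} (he : e ∈ E) :
    ∃ a, IsTransversalOf part a e := by
  choose a ha using fun j => card_eq_one.mp (hP e he j)
  have key : ∀ j v, (v ∈ e ∧ part v = j) ↔ v = a j := fun j v => by
    simpa using Finset.ext_iff.mp (ha j) v
  exact ⟨a, fun j => ((key j _).2 rfl).2, fun v => by rw [← key]; simp⟩

namespace IsTransversalOf

variable {V : Type} {r : ℕ} {part : V → Fin r} {a b : Fin r → V} {e f : Finset V}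

theorem apply_mem (ha : IsTransversalOf part a e) (j : Fin r) : a j ∈ e := by
  rw [ha.mem_iff, ha.part_apply]

theorem apply_mem_iff (ha : IsTransversalOf part a e) (hb : IsTransversalOf part b f)
    (j : Fin r) : a j ∈ f ↔ a j = b j := by
  rw [hb.mem_iff, ha.part_apply]

theorem ncard_eq (ha : IsTransversalOf part a e) {s : Set V} (hs : s ⊆ e)
    (p : Fin r → Prop) [DecidablePred p] (hp : ∀ j, a j ∈ s ↔ p j) :
    s.ncard = #{j | p j} := by
  classical
  have hinj : Function.Injective a := Function.LeftInverse.injective ha.part_apply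
  rw [← card_image_of_injective _ hinj, ← Set.ncard_coe_finset]
  congr 1
  ext v
  simp only [coe_image, coe_filter, mem_univ, true_and, Set.mem_image, Set.mem_ofPred_eq]
  constructor
  · intro hv
    have h := (ha.mem_iff v).1 (hs hv)
    exact ⟨part v, (hp _).1 (h ▸ hv), h.symm⟩
  · rintro ⟨j, hj, rfl⟩
    exact (hp j).2 hj

end IsTransversalOf

theorem coverNumber_le_card {V : Type} {E : Finset (Finset V)} {C : Finset V}
    (hC : IsCover E C) : coverNumber E ≤ #C :=
  Nat.sInf_le ⟨C, hC, rfl⟩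

theorem coverNumber_le_of_lt {V : Type} {r t : ℕ} {part : V → Fin r}
    {E : Finset (Finset V)} (hP : IsRPartite r part E) (hI : IntersectingGe t E)
    {e₁ e₂ e₃ : Finset V} (he₁ : e₁ ∈ E) (he₂ : e₂ ∈ E) (he₃ : e₃ ∈ E)
    {t₁ t₂ : ℕ} (ht₁ : t₁ = ((↑e₁ ∩ ↑e₂ ∩ ↑e₃ : Set V)).ncard)
    (ht₂ : t₂ = (((↑e₁ ∩ ↑e₂ : Set V)) \ ↑e₃).ncard
              + (((↑e₁ ∩ ↑e₃ : Set V)) \ ↑e₂).ncard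
              + (((↑e₂ ∩ ↑e₃ : Set V)) \ ↑e₁).ncard) :
    t₁ + t₂ ≤ r ∧ ∀ k₁ k₂ k₃ : ℕ, k₁ ≤ t₁ → k₂ ≤ 2 * t₂ → t₁ + t₂ + k₃ ≤ r →
      2 * t₁ + t₂ + r < 3 * k₁ + k₂ + k₃ + 3 * t →
      coverNumber E ≤ k₁ + k₂ + 3 * k₃ := by
  classical
  obtain ⟨a, ha⟩ := hP.exists_transversal he₁
  obtain ⟨b, hb⟩ := hP.exists_transversal he₂
  obtain ⟨c, hc⟩ := hP.exists_transversal he₃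
  set A : Finset (Fin r) := {j | a j = b j ∧ a j = c j} with hA
  set D : Finset (Fin r) := {j | a j ≠ b j ∧ a j ≠ c j ∧ b j ≠ c j} with hD
  set B : Finset (Fin r) := {j | j ∉ A ∧ j ∉ D} with hB
  have hAc : t₁ = #A := by
    rw [ht₁, ha.ncard_eq (fun v hv => hv.1.1) (fun j => a j = b j ∧ a j = c j)]
    intro j
    simp [ha.apply_mem, ha.apply_mem_iff hb, ha.apply_mem_iff hc]
  have hBc : t₂ = #B := by
    rw [ht₂, ha.ncard_eq (fun v hv => hv.1.1) (fun j => a j = b j ∧ a j ≠ c j),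
      ha.ncard_eq (fun v hv => hv.1.1) (fun j => a j = c j ∧ a j ≠ b j),
      hb.ncard_eq (fun v hv => hv.1.1) (fun j => b j = c j ∧ b j ≠ a j), hB]
    · simp only [card_filter, ← sum_add_distrib]
      refine sum_congr rfl fun j _ => ?_
      simp only [hA, hD, mem_filter, mem_univ, true_and]
      split_ifs <;> grind
    · intro j
      simp [hb.apply_mem, hb.apply_mem_iff ha, hb.apply_mem_iff hc]
    · intro j
      simp [ha.apply_mem, ha.apply_mem_iff hb, ha.apply_mem_iff hc]
    · intro j
      simp [ha.apply_mem, ha.apply_mem_iff hb, ha.apply_mem_iff hc]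
  have hcard : #A + #B + #D = r := by
    have h : ∑ j : Fin r, ((if j ∈ A then 1 else 0) + (if j ∈ B then 1 else 0)
        + (if j ∈ D then 1 else 0)) = r := by
      rw [sum_congr rfl (g := fun _ => 1) fun j _ => ?_]
      · simp
      · simp only [hB, hA, hD, mem_filter, mem_univ, true_and]
        split_ifs <;> grind
    simpa [sum_add_distrib] using h
  refine ⟨by omega, fun k₁ k₂ k₃ h₁ h₂ h₃ hlt => ?_⟩
  obtain ⟨S₁, hS₁, hk₁⟩ := exists_subset_card_eq (show k₁ ≤ #A by omega)
  obtain ⟨S₂, hS₂, hk₂⟩ := exists_subset_card_eq (show min k₂ #B ≤ #B by omega)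
  obtain ⟨S₂', hS₂', hk₂'⟩ := exists_subset_card_eq (show k₂ - min k₂ #B ≤ #S₂ by omega)
  obtain ⟨S₃, hS₃, hk₃⟩ := exists_subset_card_eq (show k₃ ≤ #D by omega)
  -- On `B`, `p` picks the vertex shared by two of the edges and `q` the remaining one.
  set p : Fin r → V := fun j => if a j = b j then a j else c j with hp
  set q : Fin r → V := fun j => if a j = b j then c j else if a j = c j then b j else a j with hq
  set C : Finset V := S₁.image a ∪ S₂.image p ∪ S₂'.image q ∪
    (S₃.image a ∪ S₃.image b ∪ S₃.image c) with hCdef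
  have hC : #C ≤ k₁ + k₂ + 3 * k₃ := by
    have i₁ := card_image_le (s := S₁) (f := a)
    have i₂ := card_image_le (s := S₂) (f := p)
    have i₃ := card_image_le (s := S₂') (f := q)
    have i₄ := card_image_le (s := S₃) (f := a)
    have i₅ := card_image_le (s := S₃) (f := b)
    have i₆ := card_image_le (s := S₃) (f := c)
    have u₁ := card_union_le (S₁.image a ∪ S₂.image p ∪ S₂'.image q)
      (S₃.image a ∪ S₃.image b ∪ S₃.image c)
    rw [← hCdef] at u₁
    have u₂ := card_union_le (S₁.image a ∪ S₂.image p) (S₂'.image q)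
    have u₃ := card_union_le (S₁.image a) (S₂.image p)
    have u₄ := card_union_le (S₃.image a ∪ S₃.image b) (S₃.image c)
    have u₅ := card_union_le (S₃.image a) (S₃.image b)
    omega
  refine (coverNumber_le_card fun f hf => ?_).trans hC
  by_contra! hfC
  obtain ⟨g, hg⟩ := hP.exists_transversal hf
  have hint : ∀ {e : Finset V} {x : Fin r → V}, e ∈ E → IsTransversalOf part x e →
      t ≤ #{j | g j = x j} := fun he hx => by
    have h := hI f hf _ he
    rwa [hg.ncard_eq Set.inter_subset_left _ fun j => by
      simp [hg.apply_mem, hg.apply_mem_iff hx]; rfl] at h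
  have ta := hint he₁ ha
  have tb := hint he₂ hb
  have tc := hint he₃ hc
  have hgC : ∀ j, g j ∉ C := fun j => hfC _ (hg.apply_mem j)
  have n₁ : ∀ j ∈ S₁, g j ≠ a j := fun j hj h => hgC j <| by
    rw [h]; simp only [hCdef, mem_union, mem_image_of_mem a hj, true_or]
  have n₂ : ∀ j ∈ S₂, g j ≠ p j := fun j hj h => hgC j <| by
    rw [h]; simp only [hCdef, mem_union, mem_image_of_mem p hj, true_or, or_true]
  have n₃ : ∀ j ∈ S₂', g j ≠ q j := fun j hj h => hgC j <| by
    rw [h]; simp only [hCdef, mem_union, mem_image_of_mem q hj, true_or, or_true]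
  have n₄ : ∀ j ∈ S₃, g j ≠ a j := fun j hj h => hgC j <| by
    rw [h]; simp only [hCdef, mem_union, mem_image_of_mem a hj, true_or, or_true]
  have n₅ : ∀ j ∈ S₃, g j ≠ b j := fun j hj h => hgC j <| by
    rw [h]; simp only [hCdef, mem_union, mem_image_of_mem b hj, true_or, or_true]
  have n₆ : ∀ j ∈ S₃, g j ≠ c j := fun j hj h => hgC j <| by
    rw [h]; simp only [hCdef, mem_union, mem_image_of_mem c hj, or_true]
  have hsum : ∑ j : Fin r, ((if g j = a j then 1 else 0) + (if g j = b j then 1 else 0)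
        + (if g j = c j then 1 else 0) + 3 * (if j ∈ S₁ then 1 else 0)
        + (if j ∈ S₂ then 1 else 0) + (if j ∈ S₂' then 1 else 0) + (if j ∈ S₃ then 1 else 0))
      ≤ ∑ j : Fin r, (3 * (if j ∈ A then 1 else 0) + 2 * (if j ∈ B then 1 else 0)
        + (if j ∈ D then 1 else 0)) := by
    refine sum_le_sum fun j _ => ?_
    have mA : j ∈ A ↔ a j = b j ∧ a j = c j := by simp [hA]
    have mD : j ∈ D ↔ a j ≠ b j ∧ a j ≠ c j ∧ b j ≠ c j := by simp [hD]
    have mB : j ∈ B ↔ j ∉ A ∧ j ∉ D := by simp [hB]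
    have s₁ := @hS₁ j
    have s₂ := @hS₂ j
    have s₂' := @hS₂' j
    have s₃ := @hS₃ j
    have m₁ := n₁ j
    have m₂ := n₂ j
    have m₃ := n₃ j
    have m₄ := n₄ j
    have m₅ := n₅ j
    have m₆ := n₆ j
    simp only [hp] at m₂
    simp only [hq] at m₃
    clear_value A B D C p q
    clear hfC hgC n₁ n₂ n₃ n₄ n₅ n₆ hS₁ hS₂ hS₂' hS₃ ta tb tc hint
    by_cases jA : j ∈ A
    · have := mA.1 jA
      grind
    by_cases jD : j ∈ D
    · have := mD.1 jD
      grind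
    have jB := mB.2 ⟨jA, jD⟩
    grind
  simp only [sum_add_distrib, ← mul_sum, ← card_filter, filter_univ_mem] at hsum
  omega

/-- **Lemma 2.6**: let `r ≥ 3t`, let `H` be an `(r,t)`-graph, let `e₁,e₂,e₃ ∈ E(H)`,
and set `t₁ = |e₁ ∩ e₂ ∩ e₃|` and
`t₂ = |e₁ ∩ e₂ \ e₃| + |e₁ ∩ e₃ \ e₂| + |e₂ ∩ e₃ \ e₁|`. Then (as integers):
if `r - 3t + 1 + t₂ ≤ t₁ ≤ r` then `3 τ(H) ≤ 2t₁ + t₂ + r - 3t + 3`;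
if `r - 3t + 1 - t₂ ≤ t₁ ≤ r - 3t + 1 + t₂` then `τ(H) ≤ r - 3t + 1 + t₂`;
if `t₁ ≤ r - 3t + 1 - t₂` then `τ(H) ≤ 3r - 2t₁ - t₂ - 9t + 3`. -/
theorem three_edge_cover_bound {V : Type} [Fintype V] (r t : ℕ)
    (ht : 1 ≤ t) (hrt : 3 * t ≤ r)
    (part : V → Fin r) (E : Finset (Finset V))
    (hP : IsRPartite r part E) (hI : IntersectingGe t E)
    (e₁ e₂ e₃ : Finset V) (he₁ : e₁ ∈ E) (he₂ : e₂ ∈ E) (he₃ : e₃ ∈ E)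
    (t₁ t₂ : ℕ)
    (ht₁ : t₁ = ((↑e₁ ∩ ↑e₂ ∩ ↑e₃ : Set V)).ncard)
    (ht₂ : t₂ = (((↑e₁ ∩ ↑e₂ : Set V)) \ ↑e₃).ncard
              + (((↑e₁ ∩ ↑e₃ : Set V)) \ ↑e₂).ncard
              + (((↑e₂ ∩ ↑e₃ : Set V)) \ ↑e₁).ncard) :
    ((r : ℤ) - 3 * t + 1 + t₂ ≤ (t₁ : ℤ) ∧ (t₁ : ℤ) ≤ (r : ℤ) →
        3 * (coverNumber E : ℤ) ≤ 2 * t₁ + t₂ + r - 3 * t + 3) ∧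
    ((r : ℤ) - 3 * t + 1 - t₂ ≤ (t₁ : ℤ) ∧ (t₁ : ℤ) ≤ (r : ℤ) - 3 * t + 1 + t₂ →
        (coverNumber E : ℤ) ≤ (r : ℤ) - 3 * t + 1 + t₂) ∧
    ((t₁ : ℤ) ≤ (r : ℤ) - 3 * t + 1 - t₂ →
        (coverNumber E : ℤ) ≤ 3 * r - 2 * t₁ - t₂ - 9 * t + 3) := by
  obtain ⟨hr, key⟩ := coverNumber_le_of_lt hP hI he₁ he₂ he₃ ht₁ ht₂
  clear ht₁ ht₂
  refine ⟨fun ⟨h, h'⟩ => ?_, fun ⟨h, h'⟩ => ?_, fun h => ?_⟩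
  · have := key ((2 * t₁ + t₂ + r - 3 * t + 3) / 3) 0 0
      (by omega) (by omega) (by omega) (by omega)
    omega
  · have := key t₁ (r + t₂ + 1 - 3 * t - t₁) 0
      (by omega) (by omega) (by omega) (by omega)
    omega
  · have := key t₁ (2 * t₂) (r + 1 - t₁ - t₂ - 3 * t)
      (by omega) (by omega) (by omega) (by omega)
    omega
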